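/- For every integer l ≥ 1 and every j ∈ ℤ, the function t ↦ ⟨T_l(J_t) e_0, e_j⟩ is a polynomial in t, and its derivative at t = 0 equals: ε_k·( dp_{k−l+1} + dp_{k−l+2} + ⋯ + dp_k ) if j = 2k − l for some integer k with 0 ≤ k ≤ l, where ε_k = 1 if k ∈ {0, l} and ε_k = 2 if 0 < k < l; dq_{k−l+1} + dq_{k−l+2} + ⋯ + dq_k if j = 2k + 1 − l for some integer k with 0 ≤ k ≤ l − 1; and 0 for every other j ∈ ℤ. -/

import Mathlib

open Polynomial
open scoped ENNReal RealInnerProductSpace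

noncomputable section

/-- The real Hilbert space `ℓ²(ℤ)`. -/
abbrev HZ : Type := lp (fun _ : ℤ => ℝ) 2

/-- The standard orthonormal basis of `ℓ²(ℤ)`. -/
def ez (k : ℤ) : HZ := lp.single 2 k 1

/-- Chebyshev polynomials of the first kind normalized to `[-2,2]`. -/
def T : ℕ → Polynomial ℝ
  | 0 => Polynomial.C 2
  | 1 => Polynomial.X
  | (n + 2) => Polynomial.X * T (n + 1) - T n

/-- An antidifference of a two-sided sequence. -/
def antidiff (f : ℤ → ℝ) : ℤ → ℝ
  | Int.ofNat n => ∑ i ∈ Finset.range n, f (i + 1)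
  | Int.negSucc n => -∑ i ∈ Finset.range (n + 1), f (-i)

lemma antidiff_add_one (f : ℤ → ℝ) (n : ℤ) : antidiff f (n + 1) = antidiff f n + f (n + 1) := by
  rcases n with n | n
  · change antidiff f (Int.ofNat (n + 1)) = _
    simp [antidiff, Finset.sum_range_succ]
  · rcases n with _ | n
    · change antidiff f (Int.ofNat 0) = _
      simp [antidiff]
    · have h : Int.negSucc (n + 1) + 1 = Int.negSucc n := by omega
      have h' : Int.negSucc n = -((n + 1 : ℕ) : ℤ) := by omega
      rw [h]
      simp only [antidiff]
      rw [Finset.sum_range_succ _ (n + 1), h']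
      ring

lemma sum_Icc_eq_antidiff (f : ℤ → ℝ) (a : ℤ) (m : ℕ) :
    ∑ i ∈ Finset.Icc (a + 1) (a + m), f i = antidiff f (a + m) - antidiff f a := by
  induction m with
  | zero => simp
  | succ m ih =>
    have h : Finset.Icc (a + 1) (a + (m + 1 : ℕ))
        = insert (a + m + 1) (Finset.Icc (a + 1) (a + m)) := by
      ext x
      simp only [Finset.mem_Icc, Finset.mem_insert]
      omega
    rw [h, Finset.sum_insert (by simp), ih]
    push_cast
    rw [← add_assoc, antidiff_add_one]
    ring

/-- The matrix entries `⟨T_l(J_t) e_k, e_j⟩` as polynomials in `t`. -/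
def chebEntry (dp dq : ℤ → ℝ) (j : ℤ) : ℕ → ℤ → Polynomial ℝ
  | 0, k => if j = k then 2 else 0
  | 1, k => (1 + X * C (dp k)) * (if j = k - 1 then 1 else 0)
      + X * C (dq k) * (if j = k then 1 else 0)
      + (1 + X * C (dp (k + 1))) * (if j = k + 1 then 1 else 0)
  | l + 2, k => (1 + X * C (dp k)) * chebEntry dp dq j (l + 1) (k - 1)
      + X * C (dq k) * chebEntry dp dq j (l + 1) k
      + (1 + X * C (dp (k + 1))) * chebEntry dp dq j (l + 1) (k + 1)
      - chebEntry dp dq j l k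

lemma inner_ez (k j : ℤ) : ⟪ez k, ez j⟫ = if j = k then (1 : ℝ) else 0 := by
  rw [ez, ez, lp.inner_single_left]
  simp [lp.single_apply, Pi.single_apply, eq_comm]

lemma inner_aeval_T_ez (dp dq : ℤ → ℝ) (t : ℝ) (J : HZ →L[ℝ] HZ)
    (hJ : ∀ k : ℤ, J (ez k)
      = (1 + t * dp k) • ez (k - 1) + (t * dq k) • ez k + (1 + t * dp (k + 1)) • ez (k + 1))
    (j : ℤ) (l : ℕ) (k : ℤ) :
    ⟪aeval J (T l) (ez k), ez j⟫ = (chebEntry dp dq j l k).eval t := by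
  induction l using Nat.twoStepInduction generalizing k with
  | zero =>
    have h : aeval J (T 0) (ez k) = (2 : ℝ) • ez k := by
      simp only [T, aeval_C, Algebra.algebraMap_eq_smul_one]
      rfl
    rw [h, real_inner_smul_left, inner_ez, chebEntry]
    split_ifs <;> simp
  | one =>
    simp only [T, aeval_X, hJ, inner_add_left, real_inner_smul_left, inner_ez, chebEntry]
    split_ifs <;> simp [mul_comm t]
  | more l ih₀ ih₁ =>
    have h : aeval J (T (l + 2)) (ez k)
        = aeval J (T (l + 1)) (J (ez k)) - aeval J (T l) (ez k) := by
      rw [T, mul_comm, map_sub, map_mul, aeval_X]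
      rfl
    rw [h, hJ]
    simp only [map_add, map_smul, inner_sub_left, inner_add_left, real_inner_smul_left, ih₀, ih₁,
      chebEntry, eval_sub, eval_add, eval_mul, eval_X, eval_C, eval_one]

lemma eval_zero_chebEntry (dp dq : ℤ → ℝ) (j : ℤ) (l : ℕ) (k : ℤ) :
    (chebEntry dp dq j l k).eval 0
      = (if j = k + l then 1 else 0) + (if j = k - l then 1 else 0) := by
  induction l using Nat.twoStepInduction generalizing k with
  | zero =>
    simp only [chebEntry, Nat.cast_zero, add_zero, sub_zero]
    split_ifs <;> norm_num
  | one =>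
    simp only [chebEntry, Nat.cast_one]
    split_ifs <;> simp
  | more l ih₀ ih₁ =>
    simp only [chebEntry, eval_sub, eval_add, eval_mul, eval_X, eval_C, eval_one, ih₀, ih₁]
    have e₁ : (j = k - 1 + ((l + 1 : ℕ) : ℤ)) = (j = k + l) := by
      rw [eq_iff_iff]; omega
    have e₂ : (j = k + 1 - ((l + 1 : ℕ) : ℤ)) = (j = k - l) := by
      rw [eq_iff_iff]; omega
    have e₃ : (j = k - 1 - ((l + 1 : ℕ) : ℤ)) = (j = k - ((l + 2 : ℕ) : ℤ)) := by
      rw [eq_iff_iff]; omega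
    have e₄ : (j = k + 1 + ((l + 1 : ℕ) : ℤ)) = (j = k + ((l + 2 : ℕ) : ℤ)) := by
      rw [eq_iff_iff]; omega
    simp only [e₁, e₂, e₃, e₄]
    ring

lemma derivative_chebEntry_add_two (dp dq : ℤ → ℝ) (j : ℤ) (l : ℕ) (k : ℤ) :
    (derivative (chebEntry dp dq j (l + 2) k)).eval 0
      = (derivative (chebEntry dp dq j (l + 1) (k - 1))).eval 0
        + (derivative (chebEntry dp dq j (l + 1) (k + 1))).eval 0
        - (derivative (chebEntry dp dq j l k)).eval 0
        + dp k * ((if j = k + l then 1 else 0) + (if j = k - l - 2 then 1 else 0))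
        + dq k * ((if j = k + l + 1 then 1 else 0) + (if j = k - l - 1 then 1 else 0))
        + dp (k + 1) * ((if j = k + l + 2 then 1 else 0) + (if j = k - l then 1 else 0)) := by
  have h := eval_zero_chebEntry dp dq j (l + 1)
  have e₁ : (j = k - 1 + ((l + 1 : ℕ) : ℤ)) = (j = k + l) := by
    rw [eq_iff_iff]; omega
  have e₂ : (j = k + 1 - ((l + 1 : ℕ) : ℤ)) = (j = k - l) := by
    rw [eq_iff_iff]; omega
  have e₃ : (j = k - 1 - ((l + 1 : ℕ) : ℤ)) = (j = k - l - 2) := by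
    rw [eq_iff_iff]; omega
  have e₄ : (j = k + 1 + ((l + 1 : ℕ) : ℤ)) = (j = k + l + 2) := by
    rw [eq_iff_iff]; omega
  have e₅ : (j = k + ((l + 1 : ℕ) : ℤ)) = (j = k + l + 1) := by
    rw [eq_iff_iff]; omega
  have e₆ : (j = k - ((l + 1 : ℕ) : ℤ)) = (j = k - l - 1) := by
    rw [eq_iff_iff]; omega
  rw [chebEntry]
  simp only [derivative_sub, derivative_add, derivative_mul, derivative_X, derivative_C,
    derivative_one, eval_sub, eval_add, eval_mul, eval_X, eval_C, eval_one, eval_zero, h,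
    e₁, e₂, e₃, e₄, e₅, e₆]
  ring

lemma derivative_chebEntry_even (dp dq : ℤ → ℝ) (l : ℕ) (j k r : ℤ) (hj : j = k + l - 2 * r) :
    (derivative (chebEntry dp dq j l k)).eval 0
      = if 0 ≤ r ∧ r ≤ l then
          (if r = 0 ∨ r = l then 1 else 2) * (antidiff dp (k + l - r) - antidiff dp (k - r))
        else 0 := by
  induction l using Nat.twoStepInduction generalizing k r with
  | zero =>
    have h : (derivative (chebEntry dp dq j 0 k)).eval 0 = 0 := by
      rw [chebEntry]
      split_ifs <;> simp
    rw [h]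
    simp
  | one =>
    have h := antidiff_add_one dp k
    have h' := antidiff_add_one dp (k - 1)
    rw [sub_add_cancel] at h'
    rw [chebEntry, if_neg (show j ≠ k by omega)]
    by_cases h0 : r = 0
    · subst h0
      rw [if_neg (by omega), if_pos (by omega)]
      simp [h]
    by_cases h1 : r = 1
    · subst h1
      rw [if_pos (by omega), if_neg (by omega)]
      simp [h']
    · rw [if_neg (by omega), if_neg (by omega), if_neg (by omega)]
      simp
  | more l ih₀ ih₁ =>
    rw [derivative_chebEntry_add_two, ih₁ (k - 1) (r - 1) (by omega), ih₁ (k + 1) r (by omega),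
      ih₀ k (r - 1) (by omega), if_neg (show j ≠ k + l + 1 by omega),
      if_neg (show j ≠ k - l - 1 by omega)]
    have a₁ : k - 1 + ((l + 1 : ℕ) : ℤ) - (r - 1) = k + l + 1 - r := by omega
    have a₂ : k - 1 - (r - 1) = k - r := by omega
    have a₃ : k + 1 + ((l + 1 : ℕ) : ℤ) - r = k + l + 2 - r := by omega
    have a₄ : k + l - (r - 1) = k + l + 1 - r := by omega
    have a₅ : k - (r - 1) = k + 1 - r := by omega
    have a₆ : k + ((l + 2 : ℕ) : ℤ) - r = k + l + 2 - r := by omega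
    rw [a₁, a₂, a₃, a₄, a₅, a₆]
    have h := antidiff_add_one dp k
    have h' := antidiff_add_one dp (k - 1)
    rw [sub_add_cancel] at h'
    have hdk : dp k = antidiff dp k - antidiff dp (k - 1) := by linarith
    have hdk' : dp (k + 1) = antidiff dp (k + 1) - antidiff dp k := by linarith
    rw [hdk, hdk']
    subst hj
    push_cast
    by_cases h0 : r = 0
    · subst h0
      simp (disch := omega) only [if_pos, if_neg, true_or, if_true]
      ring_nf
    by_cases h1 : r = 1
    · subst h1
      rcases Nat.eq_zero_or_pos l with hl | hl
      · subst hl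
        simp (disch := omega) only [if_pos, if_neg]
        ring_nf
      simp (disch := omega) only [if_pos, if_neg]
      ring_nf
    by_cases h2 : r = l + 1
    · subst h2
      simp (disch := omega) only [if_pos, if_neg, or_true, if_true]
      ring_nf
    by_cases h3 : r = l + 2
    · subst h3
      simp (disch := omega) only [if_pos, if_neg, or_true, if_true]
      ring_nf
    by_cases h4 : 0 ≤ r ∧ r ≤ l + 2
    · simp (disch := omega) only [if_pos, if_neg]
      ring_nf
    simp (disch := omega) only [if_pos, if_neg]
    ring_nf

lemma derivative_chebEntry_odd (dp dq : ℤ → ℝ) (l : ℕ) (j k r : ℤ)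
    (hj : j = k + l - 1 - 2 * r) :
    (derivative (chebEntry dp dq j l k)).eval 0
      = if 0 ≤ r ∧ r ≤ l - 1 then antidiff dq (k + l - 1 - r) - antidiff dq (k - 1 - r)
        else 0 := by
  induction l using Nat.twoStepInduction generalizing k r with
  | zero =>
    have h : (derivative (chebEntry dp dq j 0 k)).eval 0 = 0 := by
      rw [chebEntry]
      split_ifs <;> simp
    rw [h, if_neg (by omega)]
  | one =>
    have h := antidiff_add_one dq (k - 1)
    rw [sub_add_cancel] at h
    rw [chebEntry, if_neg (show j ≠ k - 1 by omega), if_neg (show j ≠ k + 1 by omega)]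
    by_cases h0 : r = 0
    · subst h0
      rw [if_pos (by omega)]
      simp [h]
    · rw [if_neg (by omega), if_neg (by omega)]
      simp
  | more l ih₀ ih₁ =>
    rw [derivative_chebEntry_add_two, ih₁ (k - 1) (r - 1) (by omega), ih₁ (k + 1) r (by omega),
      ih₀ k (r - 1) (by omega), if_neg (show j ≠ k + l by omega),
      if_neg (show j ≠ k - l - 2 by omega), if_neg (show j ≠ k + l + 2 by omega),
      if_neg (show j ≠ k - l by omega)]
    have a₁ : k - 1 + ((l + 1 : ℕ) : ℤ) - 1 - (r - 1) = k + l - r := by omega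
    have a₂ : k - 1 - 1 - (r - 1) = k - 1 - r := by omega
    have a₃ : k + 1 + ((l + 1 : ℕ) : ℤ) - 1 - r = k + l + 1 - r := by omega
    have a₄ : k + l - 1 - (r - 1) = k + l - r := by omega
    have a₅ : k - 1 - (r - 1) = k - r := by omega
    have a₆ : k + ((l + 2 : ℕ) : ℤ) - 1 - r = k + l + 1 - r := by omega
    have a₇ : k + 1 - 1 - r = k - r := by omega
    rw [a₁, a₂, a₃, a₄, a₅, a₆, a₇]
    have h := antidiff_add_one dq (k - 1)
    rw [sub_add_cancel] at h
    have hdk : dq k = antidiff dq k - antidiff dq (k - 1) := by linarith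
    rw [hdk]
    subst hj
    push_cast
    by_cases h0 : r = 0
    · subst h0
      simp (disch := omega) only [if_pos, if_neg]
      ring_nf
    by_cases h2 : r = l + 1
    · subst h2
      simp (disch := omega) only [if_pos, if_neg]
      ring_nf
    by_cases h3 : 0 ≤ r ∧ r ≤ l + 1
    · simp (disch := omega) only [if_pos, if_neg]
      ring_nf
    simp (disch := omega) only [if_neg]
    ring_nf

/-- The entries of `t ↦ T_l(J_t) e₀` are polynomials in `t`, and the derivative
at `t = 0` of `⟨T_l(J_t) e₀, e_j⟩` equals `ε_k (dp_{k-l+1} + ⋯ + dp_k)` if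
`j = 2k - l` with `0 ≤ k ≤ l` (`ε_k = 1` for `k ∈ {0, l}`, `ε_k = 2` otherwise),
`dq_{k-l+1} + ⋯ + dq_k` if `j = 2k + 1 - l` with `0 ≤ k ≤ l - 1`, and `0` otherwise. -/
theorem stmt_13
    (dp dq : ℤ → ℝ)
    (hdp : (Function.support dp).Finite) (hdq : (Function.support dq).Finite)
    (Jt : ℝ → (HZ →L[ℝ] HZ))
    (hJt : ∀ (t : ℝ) (k : ℤ), Jt t (ez k)
      = (1 + t * dp k) • ez (k - 1) + (t * dq k) • ez k + (1 + t * dp (k + 1)) • ez (k + 1))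
    (l : ℕ) (hl : 1 ≤ l) (j : ℤ) :
    (∃ P : Polynomial ℝ, ∀ t : ℝ, ⟪aeval (Jt t) (T l) (ez 0), ez j⟫ = P.eval t)
    ∧ HasDerivAt (fun t : ℝ => ⟪aeval (Jt t) (T l) (ez 0), ez j⟫)
        (if (j + l) % 2 = 0 ∧ -(l : ℤ) ≤ j ∧ j ≤ l then
          (if j = -(l : ℤ) ∨ j = (l : ℤ) then 1 else 2)
            * ∑ i ∈ Finset.Icc ((j + l) / 2 - l + 1) ((j + l) / 2), dp i
         else if (j + l) % 2 = 1 ∧ 1 - (l : ℤ) ≤ j ∧ j ≤ (l : ℤ) - 1 then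
          ∑ i ∈ Finset.Icc ((j + l - 1) / 2 - l + 1) ((j + l - 1) / 2), dq i
         else 0)
        0 := by
  have hentry : ∀ t : ℝ, ⟪aeval (Jt t) (T l) (ez 0), ez j⟫ = (chebEntry dp dq j l 0).eval t :=
    fun t => inner_aeval_T_ez dp dq t (Jt t) (hJt t) j l 0
  refine ⟨⟨_, hentry⟩, ?_⟩
  simp only [hentry]
  refine ((chebEntry dp dq j l 0).hasDerivAt 0).congr_deriv ?_
  rcases Int.emod_two_eq_zero_or_one (j + l) with hpar | hpar
  · rw [derivative_chebEntry_even dp dq l j 0 (l - (j + l) / 2) (by omega)]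
    have hs := sum_Icc_eq_antidiff dp ((j + l) / 2 - l) l
    rw [sub_add_cancel] at hs
    rw [hs, show (0 : ℤ) + l - (l - (j + l) / 2) = (j + l) / 2 by ring,
      show (0 : ℤ) - (l - (j + l) / 2) = (j + l) / 2 - l by ring]
    split_ifs <;> first | (exfalso; omega) | rfl
  · rw [derivative_chebEntry_odd dp dq l j 0 (l - 1 - (j + l - 1) / 2) (by omega)]
    have hs := sum_Icc_eq_antidiff dq ((j + l - 1) / 2 - l) l
    rw [sub_add_cancel] at hs
    rw [hs, show (0 : ℤ) + l - 1 - (l - 1 - (j + l - 1) / 2) = (j + l - 1) / 2 by ring,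
      show (0 : ℤ) - 1 - (l - 1 - (j + l - 1) / 2) = (j + l - 1) / 2 - l by ring]
    split_ifs <;> first | (exfalso; omega) | rfl

end
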